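/- arXiv:2309.11292 — 2 statements merged into one kernel-verified Lean document; each statement's English description precedes it below -/
import Mathlib

section
/- For every 𝐧 ∈ ℕ^q, every 𝐧-coloring c of [|𝐧|], every k×q matrix S of (real or complex) variables and every α ∈ ℝ^k, the pattern inventory equals the refined cycle index polynomial evaluated at the monomials Ω: 𝒵_𝐧[S;α] = Z_𝐧(Ω_𝐧[S;α]). -/
open Finset Nat
open scoped Classical

/-- `col(A) = ∑_𝐚 A(𝐚) • 𝐚`, the color count vector of a colored partition. -/
def colA {q : ℕ} (A : (Fin q → ℕ) →₀ ℕ) : Fin q → ℕ :=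
  fun j => ∑ a ∈ A.support, A a * a j

/-- The set of `q`-colored partitions of `𝐧`. -/
def CPartSet {q : ℕ} (n : Fin q → ℕ) : Set ((Fin q → ℕ) →₀ ℕ) :=
  {A | A 0 = 0 ∧ colA A = n}

/-- The multinomial coefficient `M_𝐧(A)` of a colored partition `A ⊨ 𝐧`. -/
noncomputable def Mcoef {q : ℕ} (n : Fin q → ℕ) (A : (Fin q → ℕ) →₀ ℕ) : ℝ :=
  (∏ j, (n j)! : ℝ) *
    ∏ a ∈ A.support,
      ((Nat.multinomial Finset.univ a : ℝ) ^ A a / ((∑ j, a j : ℝ) ^ A a * (A a)!))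

/-- `Z_𝐧(𝐭) = (1/𝐧!) ∑_{A ⊨ 𝐧} M_𝐧(A) ∏_{𝐚 ∈ supp A} t_𝐚^{A(𝐚)}`. -/
noncomputable def Zpoly {q : ℕ} (n : Fin q → ℕ) (t : (Fin q → ℕ) → ℝ) : ℝ :=
  (∏ j, (n j)! : ℝ)⁻¹ *
    ∑ᶠ A ∈ CPartSet n, Mcoef n A * ∏ a ∈ A.support, t a ^ A a

/-- The `𝐧`-pattern `w_𝐧[S;α](π)` of a permutation `π`: the product over all cycles of `π`
(including fixed points, which contribute the factors in the second product) of
`∑_ℓ (∏_{y ∈ cycle} s_{ℓ, c(y)}) α_ℓ`. -/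
noncomputable def patternW {N k q : ℕ} (c : Fin N → Fin q) (S : Matrix (Fin k) (Fin q) ℝ)
    (α : Fin k → ℝ) (π : Equiv.Perm (Fin N)) : ℝ :=
  (∏ κ ∈ π.cycleFactorsFinset, ∑ ℓ, (∏ y ∈ κ.support, S ℓ (c y)) * α ℓ) *
    ∏ y ∈ Finset.univ \ π.support, ∑ ℓ, S ℓ (c y) * α ℓ

section CycleSum

open Equiv Equiv.Perm

variable {X : Type*} [Fintype X] [DecidableEq X]

/-- The product, over all cycles of `π` inside `T` (fixed points included), of the value of `f` at
the set of points of the cycle. -/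
def cycleWeight (f : Finset X → ℝ) (T : Finset X) (π : Perm X) : ℝ :=
  (∏ κ ∈ π.cycleFactorsFinset, f κ.support) * ∏ y ∈ T \ π.support, f {y}

/-- The sum of the cycle weights of all permutations supported in `T`. -/
def cycleSum (f : Finset X → ℝ) (T : Finset X) : ℝ :=
  ∑ π : Perm X with π.support ⊆ T, cycleWeight f T π

theorem cycleSum_empty (f : Finset X → ℝ) : cycleSum f ∅ = 1 := by
  have h : (univ.filter fun π : Perm X => π.support ⊆ ∅) = {1} := by
    ext π
    simp
  rw [cycleSum, h]
  simp [cycleWeight]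

theorem cycleOf_eq_self_iff {κ : Perm X} {x : X} :
    κ.cycleOf x = κ ↔ κ = 1 ∨ (κ.IsCycle ∧ κ x ≠ x) := by
  constructor
  · intro h
    by_cases hx : κ x = x
    · left
      rw [← h]
      exact (cycleOf_eq_one_iff κ).2 hx
    · right
      exact ⟨h ▸ isCycle_cycleOf κ hx, hx⟩
  · rintro (rfl | ⟨h, hx⟩)
    · simp
    · exact h.cycleOf_eq hx

theorem card_isCycle_support_eq {Y : Finset X} (hY : 2 ≤ #Y) :
    #{κ : Perm X | κ.IsCycle ∧ κ.support = Y} = (#Y - 1)! := by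
  have h := card_of_cycleType_singleton (α := {y // y ∈ Y}) (n := #Y) hY (by simp)
  rw [Fintype.card_coe, Nat.choose_self, mul_one] at h
  rw [← h]
  symm
  refine Finset.card_bij (fun σ _ => Perm.ofSubtype σ) ?_ ?_ ?_
  · intro σ hσ
    rw [mem_filter] at hσ
    have hσ' : (Perm.ofSubtype σ).cycleType = {#Y} := by
      rw [cycleType_ofSubtype, hσ.2]
    have hc : (Perm.ofSubtype σ).IsCycle := by
      rw [← card_cycleType_eq_one, hσ', Multiset.card_singleton]
    refine mem_filter.2 ⟨mem_univ _, hc, ?_⟩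
    refine Finset.eq_of_subset_of_card_le ?_ ?_
    · intro y hy
      rw [mem_support_ofSubtype] at hy
      exact hy.1
    · rw [← sum_cycleType, hσ', Multiset.sum_singleton]
  · intro σ _ τ _ hστ
    exact ofSubtype_injective hστ
  · intro κ hκ
    obtain ⟨-, hc, hs⟩ := mem_filter.1 hκ
    have h₁ : ∀ y, κ y ∈ Y ↔ y ∈ Y := by
      intro y
      rw [← hs, apply_mem_support]
    have h₂ : ∀ y, κ y ≠ y → y ∈ Y := by
      intro y hy
      rw [← hs, mem_support]
      exact hy
    refine ⟨κ.subtypePerm h₁, mem_filter.2 ⟨mem_univ _, ?_⟩, ofSubtype_subtypePerm h₁ h₂⟩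
    rw [← cycleType_ofSubtype, ofSubtype_subtypePerm h₁ h₂, hc.cycleType, hs]

theorem card_cycleOf_eq_self {Y : Finset X} {x : X} (hx : x ∈ Y) :
    #{κ : Perm X | κ.cycleOf x = κ ∧ insert x κ.support = Y} = (#Y - 1)! := by
  rcases (Finset.one_le_card.2 ⟨x, hx⟩).eq_or_lt with h1 | h2
  · obtain ⟨y, rfl⟩ := Finset.card_eq_one.1 h1.symm
    obtain rfl := Finset.mem_singleton.1 hx
    have : (univ.filter fun κ : Perm X => κ.cycleOf x = κ ∧ insert x κ.support = {x}) = {1} := by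
      ext κ
      simp only [mem_filter, mem_univ, true_and, mem_singleton, cycleOf_eq_self_iff]
      constructor
      · rintro ⟨h | ⟨hc, -⟩, hs⟩
        · exact h
        · have := hc.two_le_card_support
          have hle : #κ.support ≤ #{x} := Finset.card_le_card (hs ▸ Finset.subset_insert _ _)
          rw [Finset.card_singleton] at hle
          omega
      · rintro rfl
        simp
    rw [this]
    simp
  · rw [← card_isCycle_support_eq h2]
    congr 1
    ext κ
    simp only [mem_filter, mem_univ, true_and, cycleOf_eq_self_iff]
    constructor
    · rintro ⟨rfl | ⟨hc, hx'⟩, hs⟩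
      · rw [← hs] at h2
        simp at h2
      · rw [Finset.insert_eq_of_mem (mem_support.2 hx')] at hs
        exact ⟨hc, hs⟩
    · rintro ⟨hc, hs⟩
      have hx' : x ∈ κ.support := hs ▸ hx
      exact ⟨Or.inr ⟨hc, mem_support.1 hx'⟩, by rw [Finset.insert_eq_of_mem hx', hs]⟩

theorem cycleWeight_mul (f : Finset X → ℝ) {T : Finset X} {x : X} (hx : x ∈ T) {κ σ : Perm X}
    (hκ : κ.cycleOf x = κ) (hσ : σ.support ⊆ T \ insert x κ.support) :
    cycleWeight f T (κ * σ) =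
      f (insert x κ.support) * cycleWeight f (T \ insert x κ.support) σ := by
  have hxσ : x ∉ σ.support := fun h => by simpa using hσ h
  rcases cycleOf_eq_self_iff.1 hκ with rfl | ⟨hc, hx'⟩
  · have hT : T \ σ.support = insert x ((T \ {x}) \ σ.support) := by
      ext y
      by_cases hy : y = x
      · subst hy
        simp only [mem_sdiff, mem_insert, true_or, iff_true]
        exact ⟨hx, hxσ⟩
      · simp [hy]
    simp only [cycleWeight, one_mul, support_one, insert_empty_eq]
    rw [hT, Finset.prod_insert (by simp)]
    ring
  · have hins : insert x κ.support = κ.support := Finset.insert_eq_of_mem (mem_support.2 hx')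
    rw [hins] at hσ ⊢
    have hd : κ.Disjoint σ := by
      rw [disjoint_iff_disjoint_support]
      exact (Finset.disjoint_of_subset_left hσ Finset.sdiff_disjoint).symm
    rw [cycleWeight, cycleWeight, hd.support_mul, hd.cycleFactorsFinset_mul_eq_union,
      hc.cycleFactorsFinset_eq_singleton, Finset.prod_union, Finset.prod_singleton,
      sdiff_sdiff_left, mul_assoc]
    · rfl
    · rw [← hc.cycleFactorsFinset_eq_singleton]
      exact hd.disjoint_cycleFactorsFinset

theorem cycleOf_mul_eq_left {x : X} {κ σ : Perm X} (hκ : κ.cycleOf x = κ)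
    (hd : κ.Disjoint σ) (hσ : σ x = x) : (κ * σ).cycleOf x = κ := by
  rw [cycleOf_mul_of_apply_right_eq_self hd.commute x hσ, hκ]

theorem support_cycleOf_inv_mul_subset (π : Perm X) (x : X) :
    ((π.cycleOf x)⁻¹ * π).support ⊆ π.support \ insert x (π.cycleOf x).support := by
  by_cases hx : π x = x
  · rw [(cycleOf_eq_one_iff π).2 hx]
    intro y hy
    have hy' : π y ≠ y := by simpa using hy
    have : y ≠ x := by
      rintro rfl
      exact hy' hx
    simpa [this] using hy'
  · have hmem : π.cycleOf x ∈ π.cycleFactorsFinset :=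
      cycleOf_mem_cycleFactorsFinset_iff.2 (mem_support.2 hx)
    have hins : insert x (π.cycleOf x).support = (π.cycleOf x).support := by
      apply Finset.insert_eq_of_mem
      rw [mem_support, cycleOf_apply_self]
      exact hx
    have hd := disjoint_mul_inv_of_mem_cycleFactorsFinset hmem
    have hcomm : (π.cycleOf x)⁻¹ * π = π * (π.cycleOf x)⁻¹ := by
      rw [inv_mul_eq_iff_eq_mul, ← hd.commute.eq, inv_mul_cancel_right]
    rw [hins, hcomm]
    intro y hy
    rw [mem_sdiff]
    have hy2 : y ∉ (π.cycleOf x).support :=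
      Finset.disjoint_left.1 (disjoint_iff_disjoint_support.1 hd) hy
    refine ⟨?_, hy2⟩
    rw [mem_support] at hy ⊢
    rw [notMem_support] at hy2
    intro h
    apply hy
    rw [Perm.mul_apply, Perm.inv_eq_iff_eq.2 hy2.symm, h]

theorem cycleSum_eq_sum_cycleOf (f : Finset X → ℝ) {T : Finset X} {x : X} (hx : x ∈ T) :
    cycleSum f T = ∑ κ : Perm X with κ.cycleOf x = κ ∧ insert x κ.support ⊆ T,
      f (insert x κ.support) * cycleSum f (T \ insert x κ.support) := by
  rw [cycleSum, ← Finset.sum_fiberwise_of_maps_to (g := fun π : Perm X => π.cycleOf x)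
    (t := univ.filter fun κ : Perm X => κ.cycleOf x = κ ∧ insert x κ.support ⊆ T)]
  · refine Finset.sum_congr rfl fun κ hκ => ?_
    obtain ⟨-, hκ, hκT⟩ := mem_filter.1 hκ
    rw [cycleSum, Finset.mul_sum]
    refine Finset.sum_bij' (fun π _ => κ⁻¹ * π) (fun σ _ => κ * σ) ?_ ?_ ?_ ?_ ?_
    · intro π hπ
      simp only [mem_filter, mem_univ, true_and] at hπ ⊢
      obtain ⟨hπT, rfl⟩ := hπ
      exact (support_cycleOf_inv_mul_subset π x).trans (Finset.sdiff_subset_sdiff hπT le_rfl)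
    · intro σ hσ
      simp only [mem_filter, mem_univ, true_and] at hσ ⊢
      have hd : κ.Disjoint σ := by
        rw [disjoint_iff_disjoint_support]
        refine Finset.disjoint_left.2 fun y hy hy' => ?_
        exact (mem_sdiff.1 (hσ hy')).2 (Finset.mem_insert_of_mem hy)
      refine ⟨?_, cycleOf_mul_eq_left hκ hd ?_⟩
      · rw [hd.support_mul]
        exact Finset.union_subset ((Finset.subset_insert _ _).trans hκT)
          (hσ.trans Finset.sdiff_subset)
      · rw [← notMem_support]
        exact fun h => by simpa using hσ h
    · intro π _
      simp
    · intro σ _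
      simp
    · intro π hπ
      simp only [mem_filter, mem_univ, true_and] at hπ
      obtain ⟨hπT, rfl⟩ := hπ
      rw [← cycleWeight_mul f hx hκ, mul_inv_cancel_left]
      exact (support_cycleOf_inv_mul_subset π x).trans (Finset.sdiff_subset_sdiff hπT le_rfl)
  · intro π hπ
    simp only [mem_filter, mem_univ, true_and] at hπ ⊢
    refine ⟨?_, Finset.insert_subset hx ((support_cycleOf_le π x).trans hπ)⟩
    rw [cycleOf_eq_self_iff]
    by_cases h : π x = x
    · exact Or.inl ((cycleOf_eq_one_iff π).2 h)
    · exact Or.inr ⟨isCycle_cycleOf π h, by rwa [cycleOf_apply_self]⟩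

theorem cycleSum_eq_sum_powerset (f : Finset X → ℝ) {T : Finset X} {x : X} (hx : x ∈ T) :
    cycleSum f T = ∑ Y ∈ T.powerset with x ∈ Y, (#Y - 1)! * (f Y * cycleSum f (T \ Y)) := by
  rw [cycleSum_eq_sum_cycleOf f hx,
    ← Finset.sum_fiberwise_of_maps_to (g := fun κ : Perm X => insert x κ.support)
      (t := T.powerset.filter fun Y => x ∈ Y)]
  · refine Finset.sum_congr rfl fun Y hY => ?_
    obtain ⟨hYT, hxY⟩ := mem_filter.1 hY
    rw [mem_powerset] at hYT
    rw [← card_cycleOf_eq_self hxY, ← nsmul_eq_mul, ← Finset.sum_const, Finset.filter_filter]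
    refine Finset.sum_congr ?_ ?_
    · ext κ
      simp only [mem_filter, mem_univ, true_and]
      constructor
      · rintro ⟨⟨h, -⟩, h'⟩
        exact ⟨h, h'⟩
      · rintro ⟨h, h'⟩
        exact ⟨⟨h, h' ▸ hYT⟩, h'⟩
    · intro κ hκ
      rw [(mem_filter.1 hκ).2.2]
  · intro κ hκ
    simp only [mem_filter, mem_univ, true_and, mem_powerset] at hκ ⊢
    exact ⟨hκ.2, Finset.mem_insert_self _ _⟩

theorem card_mul_cycleSum (f : Finset X → ℝ) (T : Finset X) :
    #T * cycleSum f T =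
      ∑ Y ∈ T.powerset with Y ≠ ∅, (#Y)! * (f Y * cycleSum f (T \ Y)) := by
  rw [← nsmul_eq_mul, ← Finset.sum_const,
    Finset.sum_congr rfl fun x hx => cycleSum_eq_sum_powerset f hx,
    Finset.sum_comm' (t' := T.powerset.filter fun Y => Y ≠ ∅) (s' := fun Y => Y)]
  · refine Finset.sum_congr rfl fun Y hY => ?_
    have hpos : #Y ≠ 0 := Finset.card_ne_zero.2 (nonempty_iff_ne_empty.2 (mem_filter.1 hY).2)
    rw [Finset.sum_const, nsmul_eq_mul, ← mul_assoc, ← Nat.mul_factorial_pred hpos, Nat.cast_mul]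
  · intro x Y
    simp only [mem_filter, mem_powerset]
    constructor
    · rintro ⟨-, hYT, hxY⟩
      exact ⟨hxY, hYT, Finset.ne_empty_of_mem hxY⟩
    · rintro ⟨hxY, hYT, -⟩
      exact ⟨hYT hxY, hYT, hxY⟩

end CycleSum

section ColoredPartition

variable {q : ℕ}

theorem colA_eq_sum (A : (Fin q → ℕ) →₀ ℕ) : colA A = A.sum fun a m => m • a := by
  ext j
  simp [colA, Finsupp.sum, Finset.sum_apply]

theorem colA_add_single (B : (Fin q → ℕ) →₀ ℕ) (a : Fin q → ℕ) :
    colA (B + Finsupp.single a 1) = colA B + a := by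
  rw [colA_eq_sum, colA_eq_sum, Finsupp.sum_add_index' (h := fun a m => m • a)
    (fun a => zero_smul ℕ a) (fun a m k => add_smul m k a),
    Finsupp.sum_single_index (zero_smul ℕ a), one_smul]

theorem smul_le_colA (A : (Fin q → ℕ) →₀ ℕ) (a : Fin q → ℕ) : A a • a ≤ colA A := by
  by_cases ha : a ∈ A.support
  · intro j
    exact Finset.single_le_sum (f := fun a => A a * a j) (fun _ _ => Nat.zero_le _) ha
  · rw [Finsupp.notMem_support_iff.1 ha, zero_smul]
    exact fun _ => Nat.zero_le _

theorem le_colA {A : (Fin q → ℕ) →₀ ℕ} {a : Fin q → ℕ} (ha : a ∈ A.support) : a ≤ colA A := by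
  intro j
  refine le_trans ?_ (smul_le_colA A a j)
  exact Nat.le_mul_of_pos_left _ (Nat.pos_of_ne_zero (Finsupp.mem_support_iff.1 ha))

theorem finite_CPartSet (n : Fin q → ℕ) : (CPartSet n).Finite := by
  refine (Set.finite_Iic (Finsupp.indicator (Finset.Iic n) fun _ _ => ∑ j, n j)).subset ?_
  rintro A ⟨h0, hA⟩ a
  by_cases ha : a ∈ A.support
  · rw [Finsupp.indicator_of_mem (Finset.mem_Iic.2 (hA ▸ le_colA ha))]
    obtain ⟨j, hj⟩ : ∃ j, a j ≠ 0 := by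
      by_contra! h
      have : a = 0 := funext h
      exact Finsupp.mem_support_iff.1 ha (this ▸ h0)
    calc A a ≤ A a * a j := Nat.le_mul_of_pos_right _ (Nat.pos_of_ne_zero hj)
      _ ≤ n j := hA ▸ smul_le_colA A a j
      _ ≤ ∑ j, n j := Finset.single_le_sum (fun _ _ => Nat.zero_le _) (mem_univ j)
  · rw [Finsupp.notMem_support_iff.1 ha]
    exact Nat.zero_le _

/-- The finset of `q`-colored partitions of `𝐧`. -/
noncomputable def cparts (n : Fin q → ℕ) : Finset ((Fin q → ℕ) →₀ ℕ) :=
  (finite_CPartSet n).toFinset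

theorem mem_cparts {n : Fin q → ℕ} {A : (Fin q → ℕ) →₀ ℕ} :
    A ∈ cparts n ↔ A 0 = 0 ∧ colA A = n :=
  (finite_CPartSet n).mem_toFinset

/-- The exponential weight `∏_𝐚 u_𝐚^{A(𝐚)} / A(𝐚)!` of a colored partition. -/
noncomputable def cpartWeight (u : (Fin q → ℕ) → ℝ) (A : (Fin q → ℕ) →₀ ℕ) : ℝ :=
  A.prod fun a m => u a ^ m / m !

/-- The total exponential weight of the colored partitions of `𝐧`. -/
noncomputable def cpartSum (u : (Fin q → ℕ) → ℝ) (n : Fin q → ℕ) : ℝ :=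
  ∑ A ∈ cparts n, cpartWeight u A

theorem cpartSum_zero (u : (Fin q → ℕ) → ℝ) : cpartSum u 0 = 1 := by
  have h : cparts (0 : Fin q → ℕ) = {0} := by
    ext A
    rw [mem_cparts, mem_singleton]
    constructor
    · rintro ⟨h0, hA⟩
      by_contra hne
      obtain ⟨a, ha⟩ := Finsupp.support_nonempty_iff.2 hne
      have ha0 : a = 0 := le_antisymm (hA ▸ le_colA ha) (fun _ => Nat.zero_le _)
      exact Finsupp.mem_support_iff.1 ha (ha0 ▸ h0)
    · rintro rfl
      exact ⟨rfl, by simp [colA_eq_sum]⟩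
  rw [cpartSum, h]
  simp [cpartWeight]

theorem apply_mul_cpartWeight_add_single (u : (Fin q → ℕ) → ℝ) (B : (Fin q → ℕ) →₀ ℕ)
    (a : Fin q → ℕ) :
    (((B + Finsupp.single a 1 : (Fin q → ℕ) →₀ ℕ) a : ℕ) : ℝ) *
        cpartWeight u (B + Finsupp.single a 1) =
      u a * cpartWeight u B := by
  have hfac (A : (Fin q → ℕ) →₀ ℕ) :
      cpartWeight u A = u a ^ A a / (A a)! * cpartWeight u (A.erase a) :=
    (Finsupp.mul_prod_erase' A a (fun a m => u a ^ m / (m ! : ℝ)) fun _ => by simp).symm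
  have herase : (B + Finsupp.single a 1).erase a = B.erase a := by
    rw [Finsupp.erase_add, Finsupp.erase_single, add_zero]
  rw [hfac (B + _), hfac B, herase, Finsupp.add_apply, Finsupp.single_eq_same,
    Nat.factorial_succ, pow_succ]
  have h1 : ((B a + 1 : ℕ) : ℝ) ≠ 0 := by positivity
  have h2 : ((B a)! : ℝ) ≠ 0 := by positivity
  rw [Nat.cast_mul]
  field_simp

theorem sum_apply_mul_cpartWeight (u : (Fin q → ℕ) → ℝ) {n a : Fin q → ℕ} (ha : a ≤ n)
    (ha0 : a ≠ 0) :
    ∑ A ∈ cparts n with a ∈ A.support, (A a : ℝ) * cpartWeight u A =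
      u a * cpartSum u (n - a) := by
  have hsub {A : (Fin q → ℕ) →₀ ℕ} (hA : a ∈ A.support) :
      A - Finsupp.single a 1 + Finsupp.single a 1 = A := by
    refine tsub_add_cancel_of_le ?_
    rw [Finsupp.single_le_iff]
    exact Nat.one_le_iff_ne_zero.2 (Finsupp.mem_support_iff.1 hA)
  rw [cpartSum, Finset.mul_sum]
  refine Finset.sum_bij' (fun A _ => A - Finsupp.single a 1) (fun B _ => B + Finsupp.single a 1)
    ?_ ?_ ?_ ?_ ?_
  · intro A hA
    rw [mem_filter, mem_cparts] at hA
    obtain ⟨⟨h0, hcol⟩, hmem⟩ := hA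
    rw [mem_cparts]
    refine ⟨by simp [h0], ?_⟩
    have h := colA_add_single (A - Finsupp.single a 1) a
    rw [hsub hmem, hcol] at h
    rw [h, add_tsub_cancel_right]
  · intro B hB
    obtain ⟨h0, hcol⟩ := mem_cparts.1 hB
    rw [mem_filter, mem_cparts]
    refine ⟨⟨by simp [h0, ha0], ?_⟩, by simp⟩
    rw [colA_add_single, hcol, tsub_add_cancel_of_le ha]
  · intro A hA
    exact hsub (mem_filter.1 hA).2
  · intro B _
    exact add_tsub_cancel_right _ _
  · intro A hA
    rw [← apply_mul_cpartWeight_add_single, hsub (mem_filter.1 hA).2]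

theorem sum_mul_cpartSum (u : (Fin q → ℕ) → ℝ) (n : Fin q → ℕ) :
    ((∑ j, n j : ℕ) : ℝ) * cpartSum u n =
      ∑ a ∈ Finset.Iic n with a ≠ 0, ((∑ j, a j : ℕ) : ℝ) * (u a * cpartSum u (n - a)) := by
  have hterm : ∀ A ∈ cparts n, ((∑ j, n j : ℕ) : ℝ) * cpartWeight u A =
      ∑ a ∈ A.support, ((∑ j, a j : ℕ) : ℝ) * ((A a : ℝ) * cpartWeight u A) := by
    intro A hA
    have hn : ∑ j, n j = ∑ a ∈ A.support, (∑ j, a j) * A a := by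
      rw [← (mem_cparts.1 hA).2]
      simp only [colA]
      rw [Finset.sum_comm]
      refine Finset.sum_congr rfl fun a _ => ?_
      rw [← Finset.mul_sum, mul_comm]
    rw [hn, Nat.cast_sum, Finset.sum_mul]
    refine Finset.sum_congr rfl fun a _ => ?_
    rw [Nat.cast_mul, mul_assoc]
  rw [cpartSum, Finset.mul_sum, Finset.sum_congr rfl hterm,
    Finset.sum_comm' (t' := (Finset.Iic n).filter fun a => a ≠ 0)
      (s' := fun a => (cparts n).filter fun A => a ∈ A.support)]
  · refine Finset.sum_congr rfl fun a ha => ?_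
    obtain ⟨han, ha0⟩ := mem_filter.1 ha
    rw [← Finset.mul_sum, sum_apply_mul_cpartWeight u (Finset.mem_Iic.1 han) ha0]
  · intro A a
    simp only [mem_filter, Finset.mem_Iic]
    constructor
    · rintro ⟨hA, ha⟩
      obtain ⟨h0, hcol⟩ := mem_cparts.1 hA
      refine ⟨⟨hA, ha⟩, hcol ▸ le_colA ha, ?_⟩
      rintro rfl
      exact Finsupp.mem_support_iff.1 ha h0
    · rintro ⟨h, -⟩
      exact h

theorem Zpoly_eq_cpartSum (n : Fin q → ℕ) (t : (Fin q → ℕ) → ℝ) :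
    Zpoly n t =
      cpartSum (fun a => Nat.multinomial Finset.univ a / ((∑ j, a j : ℕ) : ℝ) * t a) n := by
  have hn : (∏ j, (n j)! : ℝ) ≠ 0 := Finset.prod_ne_zero_iff.2 fun j _ => by positivity
  rw [Zpoly, finsum_mem_eq_finite_toFinset_sum _ (finite_CPartSet n), Finset.mul_sum]
  refine Finset.sum_congr rfl fun A _ => ?_
  rw [Mcoef, mul_assoc, inv_mul_cancel_left₀ hn, ← Finset.prod_mul_distrib]
  refine Finset.prod_congr rfl fun a _ => ?_
  simp only [mul_pow, div_pow, Nat.cast_sum, ← div_div]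
  ring

end ColoredPartition

section ColorCount

variable {q : ℕ} {X : Type*} (c : X → Fin q)

/-- The number of points of each color in a finite set. -/
def colorCount (Y : Finset X) : Fin q → ℕ :=
  fun j => #{y ∈ Y | c y = j}

theorem sum_colorCount (Y : Finset X) : ∑ j, colorCount c Y j = #Y :=
  (Finset.card_eq_sum_card_fiberwise fun _ _ => mem_univ _).symm

theorem colorCount_mono {Y T : Finset X} (h : Y ⊆ T) : colorCount c Y ≤ colorCount c T :=
  fun _ => Finset.card_le_card (Finset.filter_subset_filter _ h)

theorem colorCount_eq_zero {Y : Finset X} : colorCount c Y = 0 ↔ Y = ∅ := by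
  constructor
  · intro h
    rw [← Finset.card_eq_zero, ← sum_colorCount c, h]
    simp
  · rintro rfl
    rfl

theorem prod_pow_colorCount {M : Type*} [CommMonoid M] (s : Fin q → M) (Y : Finset X) :
    ∏ j, s j ^ colorCount c Y j = ∏ y ∈ Y, s (c y) := by
  rw [← Finset.prod_fiberwise' Y c s]
  exact Finset.prod_congr rfl fun j _ => (Finset.prod_const _).symm

variable [DecidableEq X]

theorem colorCount_sdiff {Y T : Finset X} (h : Y ⊆ T) :
    colorCount c (T \ Y) = colorCount c T - colorCount c Y := by
  ext j
  simp only [colorCount, Pi.sub_apply]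
  rw [← Finset.card_sdiff_of_subset (Finset.filter_subset_filter _ h)]
  congr 1
  ext y
  simp only [mem_filter, mem_sdiff]
  tauto

theorem card_colorCount_eq (T : Finset X) (a : Fin q → ℕ) :
    #{Y ∈ T.powerset | colorCount c Y = a} = ∏ j, (colorCount c T j).choose (a j) := by
  have hpi : #(Fintype.piFinset fun j => Finset.powersetCard (a j) {y ∈ T | c y = j}) =
      ∏ j, (colorCount c T j).choose (a j) := by
    rw [Fintype.card_piFinset]
    exact Finset.prod_congr rfl fun j _ => Finset.card_powersetCard _ _
  have hfib {g : Fin q → Finset X} (hg : ∀ j, g j ⊆ {y ∈ T | c y = j}) (j : Fin q) :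
      {y ∈ univ.biUnion g | c y = j} = g j := by
    ext y
    simp only [mem_filter, mem_biUnion, mem_univ, true_and]
    constructor
    · rintro ⟨⟨i, hi⟩, rfl⟩
      exact (mem_filter.1 (hg i hi)).2 ▸ hi
    · intro hy
      exact ⟨⟨j, hy⟩, (mem_filter.1 (hg j hy)).2⟩
  rw [← hpi]
  refine Finset.card_bij' (fun Y _ => fun j => {y ∈ Y | c y = j}) (fun g _ => univ.biUnion g)
    ?_ ?_ ?_ ?_
  · intro Y hY
    obtain ⟨hYT, rfl⟩ := mem_filter.1 hY
    rw [Fintype.mem_piFinset]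
    intro j
    rw [Finset.mem_powersetCard]
    exact ⟨Finset.filter_subset_filter _ (mem_powerset.1 hYT), rfl⟩
  · intro g hg
    simp only [Fintype.mem_piFinset, Finset.mem_powersetCard] at hg
    rw [mem_filter, mem_powerset]
    refine ⟨?_, ?_⟩
    · exact Finset.biUnion_subset.2 fun j _ => (hg j).1.trans (Finset.filter_subset _ _)
    · ext j
      rw [colorCount, hfib fun j => (hg j).1]
      exact (hg j).2
  · intro Y _
    ext y
    simp
  · intro g hg
    simp only [Fintype.mem_piFinset, Finset.mem_powersetCard] at hg
    exact funext fun j => hfib (fun j => (hg j).1) j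

theorem prod_choose_mul_factorial_mul_prod_factorial_sub {n a : Fin q → ℕ} (han : a ≤ n) :
    (∏ j, (n j).choose (a j)) * ((∑ j, a j)! * ∏ j, ((n - a) j)!) =
      (∏ j, (n j)!) * Nat.multinomial Finset.univ a := by
  have h : ∏ j, (n j)! = (∏ j, (n j).choose (a j)) * (∏ j, (a j)!) * ∏ j, ((n - a) j)! := by
    rw [← Finset.prod_mul_distrib, ← Finset.prod_mul_distrib]
    exact Finset.prod_congr rfl fun j _ => (Nat.choose_mul_factorial_mul_factorial (han j)).symm
  rw [h, ← Nat.multinomial_spec]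
  ring

theorem cycleSum_colorCount [Fintype X] (t : (Fin q → ℕ) → ℝ) (T : Finset X) :
    cycleSum (fun Y => t (colorCount c Y)) T = (∏ j, (colorCount c T j)! : ℝ) *
      cpartSum (fun a => Nat.multinomial Finset.univ a / ((∑ j, a j : ℕ) : ℝ) * t a)
        (colorCount c T) := by
  induction T using Finset.strongInduction with
  | H T ih =>
    rcases T.eq_empty_or_nonempty with rfl | hT
    · rw [cycleSum_empty, (colorCount_eq_zero c).2 rfl, cpartSum_zero]
      simp
    have hpos : (#T : ℝ) ≠ 0 := Nat.cast_ne_zero.2 (Finset.card_ne_zero.2 hT)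
    apply mul_left_cancel₀ hpos
    rw [mul_left_comm, card_mul_cycleSum, ← sum_colorCount c T, sum_mul_cpartSum, Finset.mul_sum,
      ← Finset.sum_fiberwise_of_maps_to (g := colorCount c)
        (t := (Finset.Iic (colorCount c T)).filter fun a => a ≠ 0)]
    · refine Finset.sum_congr rfl fun a ha => ?_
      obtain ⟨han, ha0⟩ := mem_filter.1 ha
      rw [Finset.mem_Iic] at han
      have hsum : ((∑ j, a j : ℕ) : ℝ) ≠ 0 := by
        rw [Nat.cast_ne_zero]
        intro h
        exact ha0 (funext fun j => Finset.sum_eq_zero_iff.1 h j (mem_univ j))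
      have hset : ((T.powerset.filter fun Y => Y ≠ ∅).filter fun Y => colorCount c Y = a) =
          T.powerset.filter fun Y => colorCount c Y = a := by
        rw [Finset.filter_filter]
        refine Finset.filter_congr fun Y _ => and_iff_right_of_imp ?_
        rintro rfl hY
        exact ha0 ((colorCount_eq_zero c).2 hY)
      have hterm : ∀ Y ∈ T.powerset.filter fun Y => colorCount c Y = a,
          ((#Y)! : ℝ) * (t (colorCount c Y) * cycleSum (fun Y => t (colorCount c Y)) (T \ Y)) =
            (∑ j, a j)! * (t a * ((∏ j, ((colorCount c T - a) j)! : ℝ) *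
              cpartSum (fun a => Nat.multinomial Finset.univ a / ((∑ j, a j : ℕ) : ℝ) * t a)
                (colorCount c T - a))) := by
        intro Y hY
        obtain ⟨hYT, rfl⟩ := mem_filter.1 hY
        rw [mem_powerset] at hYT
        have hne : Y.Nonempty := by
          rw [Finset.nonempty_iff_ne_empty, Ne, ← colorCount_eq_zero c]
          exact ha0
        rw [ih (T \ Y) (Finset.sdiff_ssubset hYT hne), colorCount_sdiff c hYT, sum_colorCount]
      have hcoeff := congrArg (Nat.cast (R := ℝ))
        (prod_choose_mul_factorial_mul_prod_factorial_sub han)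
      push_cast at hcoeff
      rw [hset, Finset.sum_congr rfl hterm, Finset.sum_const, card_colorCount_eq, nsmul_eq_mul,
        Nat.cast_prod, ← mul_assoc (((∑ j, a j : ℕ) : ℝ)), ← mul_assoc (((∑ j, a j : ℕ) : ℝ)),
        mul_div_cancel₀ _ hsum]
      linear_combination t a * cpartSum (fun a =>
        Nat.multinomial Finset.univ a / ((∑ j, a j : ℕ) : ℝ) * t a) (colorCount c T - a) * hcoeff
    · intro Y hY
      obtain ⟨hYT, hY0⟩ := mem_filter.1 hY
      rw [mem_filter, Finset.mem_Iic, Ne, colorCount_eq_zero]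
      exact ⟨colorCount_mono c (mem_powerset.1 hYT), hY0⟩

end ColorCount

/-- **The pattern inventory equals the refined cycle index polynomial.**
For every `𝐧`-coloring `c` of `[|𝐧|]`, every `k×q` matrix `S` and every `α ∈ ℝ^k`,
`𝒵_𝐧[S;α] = (1/𝐧!) ∑_{π ∈ S_{|𝐧|}} w_𝐧[S;α](π) = Z_𝐧(Ω_𝐧[S;α])`. -/
theorem pattern_inventory_eq_cycle_index (k q : ℕ) (n : Fin q → ℕ)
    (c : Fin (∑ j, n j) → Fin q)
    (hc : ∀ j, (Finset.univ.filter fun i => c i = j).card = n j)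
    (S : Matrix (Fin k) (Fin q) ℝ) (α : Fin k → ℝ) :
    (∏ j, (n j)! : ℝ)⁻¹ * ∑ π : Equiv.Perm (Fin (∑ j, n j)), patternW c S α π =
      Zpoly n (fun a => ∑ i, (∏ j, S i j ^ a j) * α i) := by
  have hn : colorCount c univ = n := funext hc
  have hne : (∏ j, (n j)! : ℝ) ≠ 0 := Finset.prod_ne_zero_iff.2 fun j _ => by positivity
  have hw : ∑ π : Equiv.Perm (Fin (∑ j, n j)), patternW c S α π =
      cycleSum (fun Y => ∑ i, (∏ j, S i j ^ colorCount c Y j) * α i) univ := by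
    simp only [cycleSum, Finset.subset_univ, Finset.filter_true, cycleWeight, patternW,
      prod_pow_colorCount, Finset.prod_singleton]
  rw [hw, cycleSum_colorCount c (fun a => ∑ i, (∏ j, S i j ^ a j) * α i), hn,
    inv_mul_cancel_left₀ hne, Zpoly_eq_cpartSum]
end

section
/- For all integers k,q ≥ 1, every 𝐧 ∈ ℕ^q, every α ∈ ℝ₊^k, and every k×q real matrix S with columns s₁,…,s_q, the multivariate Dirichlet moment admits the expansion ∫_{Δ^{k−1}} ∏_{j=1}^q (s_j·x)^{n_j} dDir_α(x) = (𝐧!/((α₁+⋯+α_k)_{|𝐧|})) ∑_M (∏_{i=1}^k (α_i)_{row(M)_i}) S^M/M!, where the sum is over all matrices M ∈ ℕ^{k×q} whose column sums equal 𝐧, row(M)_i is the i-th row sum of M, S^M = ∏_{i,j} s_{i,j}^{m_{i,j}}, and M! = ∏_{i,j} m_{i,j}!. -/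
open Finset MeasureTheory Nat
open scoped Classical

/-- Multivariate Beta function `B(α₁,…,α_k) = Γ(α₁)⋯Γ(α_k)/Γ(α₁+⋯+α_k)`. -/
noncomputable def multiBeta {k : ℕ} (α : Fin k → ℝ) : ℝ :=
  (∏ i, Real.Gamma (α i)) / Real.Gamma (∑ i, α i)

/-- The expectation of `f` under the Dirichlet distribution `Dir_α` on the standard simplex
`Δ^{k-1} ⊆ ℝ^{k+1}`, computed in the chart given by the first `k` coordinates:
the last coordinate is `1 - ∑ y`, and the density is
`y₁^{α₁-1}⋯y_k^{α_k-1}(1-∑y)^{α_{k+1}-1}/B(α)`. -/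
noncomputable def dirMoment {k : ℕ} (α : Fin (k + 1) → ℝ) (f : (Fin (k + 1) → ℝ) → ℝ) : ℝ :=
  (∫ y in {y : Fin k → ℝ | (∀ i, 0 ≤ y i) ∧ ∑ i, y i ≤ 1},
      f (Fin.snoc y (1 - ∑ i, y i)) *
        ((∏ i, y i ^ (α (Fin.castSucc i) - 1)) * (1 - ∑ i, y i) ^ (α (Fin.last k) - 1))) /
    multiBeta α

/-- The solid simplex `{y ≥ 0, ∑ y ≤ t}` is measurable. -/
lemma measurableSet_solidSimplex (k : ℕ) (t : ℝ) :
    MeasurableSet {y : Fin k → ℝ | (∀ i, 0 ≤ y i) ∧ ∑ i, y i ≤ t} := by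
  have hsum : Measurable fun y : Fin k → ℝ => ∑ i, y i := by fun_prop
  simp only [Set.ofPred_and, Set.ofPred_forall]
  exact (MeasurableSet.iInter fun i => measurableSet_le measurable_const
    (measurable_pi_apply i)).inter (measurableSet_le hsum measurable_const)

/-- The unnormalised Dirichlet density in the chart of the first `k` coordinates, on the simplex
of total mass `t`. -/
noncomputable def dirDensity {k : ℕ} (α : Fin (k + 1) → ℝ) (t : ℝ) (y : Fin k → ℝ) : ℝ :=
  (∏ i, y i ^ (α (Fin.castSucc i) - 1)) * (t - ∑ i, y i) ^ (α (Fin.last k) - 1)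

lemma measurable_dirDensity {k : ℕ} (α : Fin (k + 1) → ℝ) (t : ℝ) :
    Measurable (dirDensity α t) := by
  unfold dirDensity
  fun_prop

lemma dirDensity_nonneg {k : ℕ} (α : Fin (k + 1) → ℝ) {t : ℝ} {y : Fin k → ℝ}
    (hy : y ∈ {y : Fin k → ℝ | (∀ i, 0 ≤ y i) ∧ ∑ i, y i ≤ t}) : 0 ≤ dirDensity α t y :=
  mul_nonneg (Finset.prod_nonneg fun i _ => Real.rpow_nonneg (hy.1 i) _)
    (Real.rpow_nonneg (sub_nonneg.2 hy.2) _)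

/-- The Beta integral over an interval of length `t`. -/
lemma lintegral_rpow_mul_sub_rpow {a b t : ℝ} (ha : 0 < a) (hb : 0 < b) (ht : 0 < t) :
    ∫⁻ u in Set.Ioo 0 t, ENNReal.ofReal (u ^ (a - 1) * (t - u) ^ (b - 1)) =
      ENNReal.ofReal (t ^ (a + b - 1) * ProbabilityTheory.beta a b) := by
  have hB := ProbabilityTheory.beta_pos ha hb
  have himage : (fun x => t * x) '' Set.Ioo (0 : ℝ) 1 = Set.Ioo 0 t := by
    simpa using Set.image_mul_left_Ioo ht 0 1
  have hone := ProbabilityTheory.lintegral_betaPDF_eq_one ha hb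
  rw [ProbabilityTheory.lintegral_betaPDF] at hone
  rw [← himage, lintegral_image_eq_lintegral_abs_deriv_mul measurableSet_Ioo
    (f' := fun _ => t) (fun x _ => by simpa using ((hasDerivAt_id x).const_mul t).hasDerivWithinAt)
    (mul_right_injective₀ ht.ne').injOn]
  conv_rhs => rw [← mul_one (ENNReal.ofReal _), ← hone]
  rw [← lintegral_const_mul _ (by fun_prop)]
  refine setLIntegral_congr_fun measurableSet_Ioo fun x hx => ?_
  have hx0 : 0 ≤ x := hx.1.le
  have hx1 : 0 ≤ 1 - x := sub_nonneg.2 hx.2.le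
  rw [← ENNReal.ofReal_mul (abs_nonneg t), ← ENNReal.ofReal_mul (by positivity), abs_of_pos ht,
    show t - t * x = t * (1 - x) by ring, Real.mul_rpow ht.le hx0, Real.mul_rpow ht.le hx1,
    show a + b - 1 = 1 + (a - 1) + (b - 1) by ring, Real.rpow_add ht, Real.rpow_add ht,
    Real.rpow_one]
  congr 1
  field_simp

lemma sum_pos_of_pos {k : ℕ} {α : Fin (k + 1) → ℝ} (hα : ∀ i, 0 < α i) : 0 < ∑ i, α i :=
  Finset.sum_pos (fun i _ => hα i) Finset.univ_nonempty

lemma multiBeta_pos {k : ℕ} {α : Fin (k + 1) → ℝ} (hα : ∀ i, 0 < α i) : 0 < multiBeta α :=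
  div_pos (Finset.prod_pos fun i _ => Real.Gamma_pos_of_pos (hα i))
    (Real.Gamma_pos_of_pos (sum_pos_of_pos hα))

lemma multiBeta_succ {k : ℕ} {α : Fin (k + 2) → ℝ} (hα : ∀ i, 0 < α i) :
    multiBeta α = multiBeta (Fin.tail α) * ProbabilityTheory.beta (α 0) (∑ i, Fin.tail α i) := by
  have h : Real.Gamma (∑ i, Fin.tail α i) ≠ 0 :=
    (Real.Gamma_pos_of_pos (sum_pos_of_pos fun i => hα i.succ)).ne'
  rw [multiBeta, multiBeta, ProbabilityTheory.beta, Fin.prod_univ_succ, Fin.sum_univ_succ]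
  change _ * (∏ i, Real.Gamma (Fin.tail α i)) / Real.Gamma (_ + ∑ i, Fin.tail α i) = _
  field_simp

lemma dirDensity_cons {k : ℕ} (α : Fin (k + 2) → ℝ) (t u : ℝ) (z : Fin k → ℝ) :
    dirDensity α t (Fin.cons u z) = u ^ (α 0 - 1) * dirDensity (Fin.tail α) (t - u) z := by
  simp [dirDensity, Fin.prod_univ_succ, Fin.sum_univ_succ, Fin.tail, mul_assoc, sub_sub]

/-- **Dirichlet integral** over the simplex of total mass `t`. -/
lemma lintegral_dirDensity {k : ℕ} {α : Fin (k + 1) → ℝ} (hα : ∀ i, 0 < α i) {t : ℝ}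
    (ht : 0 < t) :
    ∫⁻ y in {y : Fin k → ℝ | (∀ i, 0 ≤ y i) ∧ ∑ i, y i ≤ t}, ENNReal.ofReal (dirDensity α t y) =
      ENNReal.ofReal (t ^ (∑ i, α i - 1) * multiBeta α) := by
  induction k generalizing t with
  | zero =>
    have h : Real.Gamma (α 0) ≠ 0 := (Real.Gamma_pos_of_pos (hα 0)).ne'
    rw [← lintegral_indicator (measurableSet_solidSimplex 0 t), lintegral_unique]
    simp [dirDensity, multiBeta, h, ht.le, volume_pi]
  | succ k ih =>
    have htail : ∀ i, 0 < Fin.tail α i := fun i => hα i.succ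
    have hmeas := (measurable_dirDensity α t).ennreal_ofReal.indicator
      (measurableSet_solidSimplex (k + 1) t)
    have hmp := (volume_preserving_piFinSuccAbove (fun _ : Fin (k + 1) => ℝ) 0).symm
    have hslice : ∀ u : ℝ, u ≠ 0 → u ≠ t →
        ∫⁻ z : Fin k → ℝ, Set.indicator {y : Fin (k + 1) → ℝ | (∀ i, 0 ≤ y i) ∧ ∑ i, y i ≤ t}
          (fun y => ENNReal.ofReal (dirDensity α t y)) (Fin.cons u z : Fin (k + 1) → ℝ) =
        Set.indicator (Set.Ioo 0 t) (fun u => ENNReal.ofReal (multiBeta (Fin.tail α)) *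
          ENNReal.ofReal (u ^ (α 0 - 1) * (t - u) ^ (∑ i, Fin.tail α i - 1))) u := by
      intro u hu0 hut
      by_cases hu : u ∈ Set.Ioo 0 t
      · have hupos : 0 < u := hu.1
        have htu : 0 < t - u := sub_pos.2 hu.2
        rw [Set.indicator_of_mem hu, ← ENNReal.ofReal_mul (multiBeta_pos htail).le,
          show multiBeta (Fin.tail α) * (u ^ (α 0 - 1) * (t - u) ^ (∑ i, Fin.tail α i - 1)) =
            u ^ (α 0 - 1) * ((t - u) ^ (∑ i, Fin.tail α i - 1) * multiBeta (Fin.tail α)) by ring,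
          ENNReal.ofReal_mul (Real.rpow_nonneg hupos.le _), ← ih htail htu,
          ← lintegral_const_mul _ (measurable_dirDensity _ _).ennreal_ofReal,
          ← lintegral_indicator (measurableSet_solidSimplex k (t - u))]
        refine lintegral_congr fun z => ?_
        simp only [Set.indicator_apply, Set.mem_ofPred_eq, Fin.forall_fin_succ, Fin.cons_zero,
          Fin.cons_succ, hupos.le, true_and, Fin.sum_univ_succ, dirDensity_cons,
          ← ENNReal.ofReal_mul (Real.rpow_nonneg hupos.le _), le_sub_iff_add_le']
      · rw [Set.indicator_of_notMem hu, ← lintegral_zero]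
        refine lintegral_congr fun z => Set.indicator_of_notMem (fun hz => hu ?_) _
        obtain ⟨hz, hsum⟩ := hz
        rw [Fin.sum_univ_succ] at hsum
        have hnonneg : 0 ≤ ∑ i : Fin k, (Fin.cons u z : Fin (k + 1) → ℝ) i.succ :=
          Finset.sum_nonneg fun i _ => hz i.succ
        have hu' : 0 ≤ u := hz 0
        simp only [Fin.cons_zero] at hsum
        exact ⟨lt_of_le_of_ne hu' hu0.symm, lt_of_le_of_ne (by linarith) hut⟩
    rw [← lintegral_indicator (measurableSet_solidSimplex (k + 1) t), ← hmp.lintegral_comp hmeas,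
      Measure.volume_eq_prod]
    refine (lintegral_prod _ (hmeas.comp hmp.measurable).aemeasurable).trans ?_
    have hcons : ∀ (u : ℝ) (z : Fin k → ℝ),
        (MeasurableEquiv.piFinSuccAbove (fun _ : Fin (k + 1) => ℝ) 0).symm (u, z) =
          Fin.cons u z := fun u z => Fin.insertNth_zero' u z
    simp only [Function.comp_apply, hcons]
    have hae : ∀ᵐ u : ℝ, u ≠ 0 ∧ u ≠ t :=
      (Measure.ae_ne volume 0).and (Measure.ae_ne volume t)
    refine (lintegral_congr_ae (hae.mono fun u hu => hslice u hu.1 hu.2)).trans ?_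
    rw [lintegral_indicator measurableSet_Ioo, lintegral_const_mul _ (by fun_prop),
      lintegral_rpow_mul_sub_rpow (hα 0) (sum_pos_of_pos htail) ht,
      ← ENNReal.ofReal_mul (multiBeta_pos htail).le, multiBeta_succ hα, Fin.sum_univ_succ α]
    congr 1
    exact mul_left_comm _ _ _

lemma integrableOn_dirDensity {k : ℕ} {α : Fin (k + 1) → ℝ} (hα : ∀ i, 0 < α i) :
    IntegrableOn (dirDensity α 1) {y : Fin k → ℝ | (∀ i, 0 ≤ y i) ∧ ∑ i, y i ≤ 1} := by
  refine ⟨(measurable_dirDensity α 1).aestronglyMeasurable, ?_⟩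
  rw [hasFiniteIntegral_iff_ofReal (ae_restrict_of_forall_mem (measurableSet_solidSimplex k 1)
    fun y hy => dirDensity_nonneg α hy), lintegral_dirDensity hα one_pos]
  exact ENNReal.ofReal_lt_top

/-- **Dirichlet integral** over the standard simplex. -/
lemma integral_dirDensity {k : ℕ} {α : Fin (k + 1) → ℝ} (hα : ∀ i, 0 < α i) :
    ∫ y in {y : Fin k → ℝ | (∀ i, 0 ≤ y i) ∧ ∑ i, y i ≤ 1}, dirDensity α 1 y = multiBeta α := by
  rw [integral_eq_lintegral_of_nonneg_ae (ae_restrict_of_forall_mem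
    (measurableSet_solidSimplex k 1) fun y hy => dirDensity_nonneg α hy)
    (measurable_dirDensity α 1).aestronglyMeasurable, lintegral_dirDensity hα one_pos,
    Real.one_rpow, one_mul, ENNReal.toReal_ofReal (multiBeta_pos hα).le]

lemma pow_mul_rpow_sub_one {x a : ℝ} (hx : 0 ≤ x) (ha : 0 < a) (r : ℕ) :
    x ^ r * x ^ (a - 1) = x ^ (a + r - 1) := by
  rcases hx.eq_or_lt with rfl | hx
  · rcases r.eq_zero_or_pos with rfl | hr
    · simp
    · have : (1 : ℝ) ≤ r := by exact_mod_cast hr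
      rw [zero_pow hr.ne', zero_mul, Real.zero_rpow (by linarith)]
  · rw [← Real.rpow_natCast, ← Real.rpow_add hx]
    congr 1
    ring

/-- Multiplying the Dirichlet density by a monomial shifts its parameters. -/
lemma monomial_mul_dirDensity {k : ℕ} {α : Fin (k + 1) → ℝ} (hα : ∀ i, 0 < α i)
    (r : Fin (k + 1) → ℕ) {y : Fin k → ℝ}
    (hy : y ∈ {y : Fin k → ℝ | (∀ i, 0 ≤ y i) ∧ ∑ i, y i ≤ 1}) :
    (∏ i, (Fin.snoc y (1 - ∑ i, y i) : Fin (k + 1) → ℝ) i ^ r i) * dirDensity α 1 y =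
      dirDensity (fun i => α i + r i) 1 y := by
  simp only [dirDensity, Fin.prod_univ_castSucc, Fin.snoc_castSucc, Fin.snoc_last]
  rw [mul_mul_mul_comm, ← Finset.prod_mul_distrib,
    pow_mul_rpow_sub_one (sub_nonneg.2 hy.2) (hα _)]
  congr 1
  exact Finset.prod_congr rfl fun i _ => pow_mul_rpow_sub_one (hy.1 i) (hα _) _

lemma Gamma_add_natCast_eq_ascPochhammer {a : ℝ} (ha : 0 < a) (r : ℕ) :
    Real.Gamma (a + r) = (ascPochhammer ℝ r).eval a * Real.Gamma a := by
  induction r with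
  | zero => simp
  | succ r ih =>
    rw [ascPochhammer_succ_eval, Nat.cast_succ, ← add_assoc, Real.Gamma_add_one (by positivity), ih]
    ring

lemma multiBeta_add_natCast {k : ℕ} {α : Fin (k + 1) → ℝ} (hα : ∀ i, 0 < α i)
    (r : Fin (k + 1) → ℕ) :
    multiBeta (fun i => α i + r i) =
      (∏ i, (ascPochhammer ℝ (r i)).eval (α i)) /
        (ascPochhammer ℝ (∑ i, r i)).eval (∑ i, α i) * multiBeta α := by
  simp only [multiBeta, Gamma_add_natCast_eq_ascPochhammer (hα _), Finset.prod_mul_distrib,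
    Finset.sum_add_distrib, ← Nat.cast_sum,
    Gamma_add_natCast_eq_ascPochhammer (sum_pos_of_pos hα)]
  exact mul_div_mul_comm _ _ _ _

/-- The moment of a finite linear combination of monomials. -/
lemma dirMoment_sum_monomial {k : ℕ} {α : Fin (k + 1) → ℝ} (hα : ∀ i, 0 < α i) {ι : Type*}
    (s : Finset ι) (c : ι → ℝ) (r : ι → Fin (k + 1) → ℕ) :
    dirMoment α (fun x => ∑ p ∈ s, c p * ∏ i, x i ^ r p i) =
      ∑ p ∈ s, c p * ((∏ i, (ascPochhammer ℝ (r p i)).eval (α i)) /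
        (ascPochhammer ℝ (∑ i, r p i)).eval (∑ i, α i)) := by
  have hpos : ∀ p i, 0 < α i + r p i := fun p i => by have := hα i; positivity
  rw [dirMoment, setIntegral_congr_fun (g := fun y => ∑ p ∈ s, c p *
    dirDensity (fun i => α i + r p i) 1 y) (measurableSet_solidSimplex k 1),
    integral_finsetSum _ fun p _ => (integrableOn_dirDensity (hpos p)).const_mul _]
  · simp only [integral_const_mul, integral_dirDensity (hpos _), multiBeta_add_natCast hα]
    rw [Finset.sum_div]
    refine Finset.sum_congr rfl fun p _ => ?_
    rw [← mul_assoc, mul_div_cancel_right₀ _ (multiBeta_pos hα).ne']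
  · intro y hy
    simp only [← monomial_mul_dirDensity hα _ hy, ← mul_assoc, ← Finset.sum_mul]
    simp only [dirDensity, mul_assoc]

/-- Multinomial expansion of a product of powers of linear forms. -/
lemma prod_linear_pow_eq_sum {ι κ : Type*} [Fintype ι] [Fintype κ] [DecidableEq ι]
    [DecidableEq κ] (n : κ → ℕ)
    (S : Matrix ι κ ℝ) (x : ι → ℝ) :
    ∏ j, (∑ i, S i j * x i) ^ n j =
      ∑ p ∈ Fintype.piFinset fun j => piAntidiag univ (n j),
        ((∏ j, (n j)! : ℝ) * ((∏ i, ∏ j, S i j ^ p j i) / ∏ i, ∏ j, ((p j i)! : ℝ))) *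
          ∏ i, x i ^ ∑ j, p j i := by
  simp only [Finset.sum_pow_eq_sum_piAntidiag]
  rw [Finset.prod_univ_sum]
  refine Finset.sum_congr rfl fun p hp => ?_
  have hsum : ∀ j, ∑ i, p j i = n j := fun j => by
    simpa using Fintype.mem_piFinset.1 hp j
  have hmult : ∀ j, (Nat.multinomial univ (p j) : ℝ) = (n j)! / ∏ i, ((p j i)! : ℝ) := fun j => by
    rw [eq_div_iff (Finset.prod_ne_zero_iff.2 fun i _ => by positivity), mul_comm, ← hsum j]
    exact_mod_cast Nat.multinomial_spec univ (p j)
  simp only [hmult, mul_pow, Finset.prod_mul_distrib, Finset.prod_div_distrib,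
    ← Finset.prod_pow_eq_pow_sum]
  rw [Finset.prod_comm (f := fun i j => S i j ^ p j i),
    Finset.prod_comm (f := fun i j => x i ^ p j i),
    Finset.prod_comm (f := fun i j => ((p j i)! : ℝ))]
  ring

/-- A sum over matrices with prescribed column sums, indexed by their columns. -/
lemma finsum_mem_matrix_eq_sum_piFinset {ι κ : Type*} [Fintype ι] [Fintype κ] [DecidableEq ι]
    [DecidableEq κ] (n : κ → ℕ)
    (f : Matrix ι κ ℕ → ℝ) :
    ∑ᶠ M ∈ {M : Matrix ι κ ℕ | ∀ j, ∑ i, M i j = n j}, f M =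
      ∑ p ∈ Fintype.piFinset fun j => piAntidiag univ (n j), f (fun i j => p j i) := by
  rw [← finsum_mem_coe_finset]
  refine (finsum_mem_eq_of_bijOn (fun (p : κ → ι → ℕ) i j => p j i) ⟨?_, ?_, ?_⟩ fun _ _ => rfl).symm
  · intro p hp j
    simpa using Fintype.mem_piFinset.1 (Finset.mem_coe.1 hp) j
  · intro p _ p' _ h
    funext j i
    exact congrFun (congrFun h i) j
  · intro M hM
    refine ⟨fun j i => M i j, Finset.mem_coe.2 (Fintype.mem_piFinset.2 fun j => ?_), rfl⟩
    simpa using hM j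

/-- **Multivariate Dirichlet moment expansion.** For `k,q ≥ 1`, `𝐧 ∈ ℕ^q`, `α ∈ ℝ₊^k`
and a real `k×q` matrix `S` with columns `s₁,…,s_q`,
`∫ ∏_j (s_j·x)^{n_j} dDir_α = (𝐧!/(|α|)_{|𝐧|}) ∑_{M : col sums = 𝐧} (∏_i (α_i)_{row(M)_i}) S^M/M!`. -/
theorem dirichlet_moment_expansion (k q : ℕ) (hq : 1 ≤ q) (n : Fin q → ℕ)
    (α : Fin (k + 1) → ℝ) (hα : ∀ i, 0 < α i) (S : Matrix (Fin (k + 1)) (Fin q) ℝ) :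
    dirMoment α (fun x => ∏ j, (∑ i, S i j * x i) ^ n j) =
      (∏ j, (n j)! : ℝ) / (ascPochhammer ℝ (∑ j, n j)).eval (∑ i, α i) *
        ∑ᶠ M ∈ {M : Matrix (Fin (k + 1)) (Fin q) ℕ | ∀ j, ∑ i, M i j = n j},
          (∏ i, (ascPochhammer ℝ (∑ j, M i j)).eval (α i)) *
            ((∏ i, ∏ j, S i j ^ M i j) / ∏ i, ∏ j, ((M i j)! : ℝ)) := by
  simp only [prod_linear_pow_eq_sum]
  rw [dirMoment_sum_monomial hα, finsum_mem_matrix_eq_sum_piFinset, Finset.mul_sum]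
  refine Finset.sum_congr rfl fun p hp => ?_
  have hsum : ∑ i, ∑ j, p j i = ∑ j, n j := by
    rw [Finset.sum_comm]
    exact Finset.sum_congr rfl fun j _ => by simpa using Fintype.mem_piFinset.1 hp j
  rw [hsum]
  ring
end
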